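/- Under the protocol, suppose G(t) is B-core-connected and (i,j) is a core edge. If t ≥ 2^{2/(1−α)} ⌈(32B + 8B·W(0))^{1/(β−α)}⌉ + (32B·‖x(0)‖_∞)^{2/(1−α)}, then |x̂_{i,j,in}(t) − x_j(t−1)| ≤ (9/8)/(t − 2B − 1)^α. Here W(0) = max_k x_k(0) − min_k x_k(0) and ‖x(0)‖_∞ = max_k |x_k(0)|. -/

import Mathlib

open scoped Classical

noncomputable section

/-- The rounding function `R` sending `x` to `1`, `0`, `-1` according to `x > 1`,
`-1 ≤ x ≤ 1`, `x < -1`. -/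
def Rq (y : ℝ) : ℝ := if y > 1 then 1 else if y < -1 then -1 else 0

/-- The data and evolution equations of the ternary-message average-consensus protocol
on `n` nodes.  `E t i j` means the edge `(i,j)` is present in the graph `G(t)`
(for `t ≥ 1`); `x t i` is the value of node `i` at time `t`; `xin t i j` is
`x̂_{i,j,in}(t)`, `xout t i j` is `x̂_{i,j,out}(t)` and `q t i j` is `q_{i→j}(t)`. -/
structure Protocol (n : ℕ) where
  α : ℝ
  β : ℝ
  hα : 0 < α
  hαβ : α < β
  hβ : β < 1
  E : ℕ → Fin n → Fin n → Prop
  Esymm : ∀ t i j, E t i j → E t j i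
  Eirrefl : ∀ t i, ¬ E t i i
  D : Fin n → Fin n → ℕ → ℝ
  Dsymm : ∀ i j t, D i j t = D j i t
  Dbound : ∀ t i j, E t i j →
    ((max (Set.ncard {k | E t i k}) (Set.ncard {k | E t j k}) : ℕ) : ℝ) ≤ D i j t
  x : ℕ → Fin n → ℝ
  xin : ℕ → Fin n → Fin n → ℝ
  xout : ℕ → Fin n → Fin n → ℝ
  q : ℕ → Fin n → Fin n → ℝ
  hxin0 : ∀ i j, xin 0 i j = 0
  hxout0 : ∀ i j, xout 0 i j = 0
  hq : ∀ t, 1 ≤ t → ∀ i j, E t i j →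
    q t i j = Rq ((t : ℝ) ^ α * (x (t - 1) i - xout (t - 1) i j))
  hxoutE : ∀ t, 1 ≤ t → ∀ i j, E t i j →
    xout t i j = xout (t - 1) i j + q t i j / (t : ℝ) ^ α
  hxinE : ∀ t, 1 ≤ t → ∀ i j, E t i j →
    xin t i j = xin (t - 1) i j + q t j i / (t : ℝ) ^ α
  hxoutN : ∀ t, 1 ≤ t → ∀ i j, ¬ E t i j → xout t i j = xout (t - 1) i j
  hxinN : ∀ t, 1 ≤ t → ∀ i j, ¬ E t i j → xin t i j = xin (t - 1) i j
  hx : ∀ t, 1 ≤ t → ∀ i, x t i = x (t - 1) i + (1 / (t : ℝ) ^ β) *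
    ∑ j ∈ Finset.univ.filter (fun j => E t i j ∧
        4 / (t : ℝ) ^ α < |xin t i j - xout t i j| ∧ q t j i = 0 ∧ q t i j = 0),
      (xin t i j - xout t i j) / (4 * D i j t)

namespace Protocol

variable {n : ℕ} (P : Protocol n)

/-- The set `S(i,t)` of neighbors that node `i` includes in its update at time `t`. -/
def S (t : ℕ) (i : Fin n) : Finset (Fin n) :=
  Finset.univ.filter (fun j => P.E t i j ∧
    4 / (t : ℝ) ^ P.α < |P.xin t i j - P.xout t i j| ∧ P.q t j i = 0 ∧ P.q t i j = 0)

/-- The graph sequence of the protocol is `B`-core-connected with core edge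
relation `Einf`: every core edge appears at some time, the graph of core edges is
connected, and every core edge appears in every time window `[kB+1, (k+1)B]`. -/
def CoreConnected (B : ℕ) (Einf : Fin n → Fin n → Prop) : Prop :=
  (∀ i j, Einf i j → ∃ t, 1 ≤ t ∧ P.E t i j) ∧
  (SimpleGraph.fromRel Einf).Connected ∧
  ∀ k : ℕ, ∀ i j, Einf i j → ∃ t, k * B + 1 ≤ t ∧ t ≤ (k + 1) * B ∧ P.E t i j

end Protocol

/-- `M(x)`: the largest coordinate. -/
def maxV {n : ℕ} (y : Fin n → ℝ) : ℝ := ⨆ i, y i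

/-- `m(x)`: the smallest coordinate. -/
def minV {n : ℕ} (y : Fin n → ℝ) : ℝ := ⨅ i, y i

/-- `W(x) = M(x) - m(x)`. -/
def Wsp {n : ℕ} (y : Fin n → ℝ) : ℝ := maxV y - minV y

/-- The sup norm `‖x‖_∞ = max_i |x_i|`. -/
def normInf {n : ℕ} (y : Fin n → ℝ) : ℝ := ⨆ i, |y i|

/-- `V2(x) = sqrt(Σ_i (x_i - (1/n) Σ_j x_j)²)`. -/
def V2 {n : ℕ} (y : Fin n → ℝ) : ℝ :=
  Real.sqrt (∑ i, (y i - (∑ j, y j) / n) ^ 2)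

lemma Rq_contract {r d : ℝ} (hr : 0 < r) : |d - Rq (r * d) / r| ≤ |d| := by
  have h1 : r * (1 / r) = 1 := by field_simp
  have h2 : 0 < 1 / r := by positivity
  unfold Rq
  split_ifs with h h'
  · have : 1 / r < d := by nlinarith
    rw [abs_of_pos (by linarith), abs_of_pos (by linarith)]; linarith
  · have : d < -(1 / r) := by nlinarith
    rw [neg_div, abs_of_neg (by linarith), abs_of_neg (by linarith)]; linarith
  · simp

lemma Rq_progress {r d : ℝ} (hr : 0 < r) :
    |d - Rq (r * d) / r| ≤ 1 / r ∨ |d - Rq (r * d) / r| ≤ |d| - 1 / r := by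
  have h1 : r * (1 / r) = 1 := by field_simp
  have h2 : 0 < 1 / r := by positivity
  unfold Rq
  split_ifs with h h'
  · have : 1 / r < d := by nlinarith
    right
    rw [abs_of_pos (by linarith), abs_of_pos (by linarith)]
  · have : d < -(1 / r) := by nlinarith
    right
    rw [neg_div, abs_of_neg (by linarith), abs_of_neg (by linarith)]; linarith
  · left
    rw [zero_div, sub_zero, abs_le]
    constructor <;> nlinarith

lemma abs_le_of_Rq_eq_zero {r d : ℝ} (hr : 0 < r) (h0 : Rq (r * d) = 0) : |d| ≤ 1 / r := by
  have h1 : r * (1 / r) = 1 := by field_simp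
  unfold Rq at h0
  split_ifs at h0 with h h'
  · norm_num at h0
  · norm_num at h0
  · rw [abs_le]
    constructor <;> nlinarith

lemma abs_add_Rq_le {r x y X : ℝ} (hr : 0 < r) (hx : |x| ≤ X) (hy : |y| ≤ X) :
    |y + Rq (r * (x - y)) / r| ≤ X := by
  have h1 : r * (1 / r) = 1 := by field_simp
  have h2 : 0 < 1 / r := by positivity
  rw [abs_le] at hx hy ⊢
  unfold Rq
  split_ifs with h h'
  · have : 1 / r < x - y := by nlinarith
    constructor <;> linarith
  · have : x - y < -(1 / r) := by nlinarith
    rw [neg_div]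
    constructor <;> linarith
  · simpa using hy

/-- Comparison of `1 / u ^ a` and `1 / v ^ a` when `v` exceeds `u` by a bounded factor. -/
lemma one_div_rpow_le_mul {a u v c : ℝ} (ha0 : 0 ≤ a) (ha1 : a ≤ 1) (hu : 0 < u) (hv : 0 < v)
    (hc : 1 ≤ c) (h : v ≤ c * u) : 1 / u ^ a ≤ c * (1 / v ^ a) := by
  have h1 : v ^ a ≤ c * u ^ a := by
    calc v ^ a ≤ (c * u) ^ a := Real.rpow_le_rpow hv.le h ha0
      _ = c ^ a * u ^ a := Real.mul_rpow (by linarith) hu.le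
      _ ≤ c * u ^ a := by
        gcongr
        simpa using Real.rpow_le_rpow_of_exponent_le hc ha1
  have hu' : 0 < u ^ a := Real.rpow_pos_of_pos hu a
  have hv' : 0 < v ^ a := Real.rpow_pos_of_pos hv a
  rw [mul_one_div, div_le_div_iff₀ hu' hv']
  linarith

lemma Finset.sum_le_of_le_div_card {ι : Type*} (S : Finset ι) {f : ι → ℝ} {a : ℝ} (ha : 0 ≤ a)
    (h : ∀ j ∈ S, f j ≤ a / S.card) : ∑ j ∈ S, f j ≤ a := by
  refine (Finset.sum_le_card_nsmul S f _ h).trans ?_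
  rw [nsmul_eq_mul]
  rcases Nat.eq_zero_or_pos S.card with h0 | h0
  · simpa [h0] using ha
  · have : (S.card : ℝ) ≠ 0 := by positivity
    rw [mul_div_cancel₀ _ this]

namespace Protocol

variable {n : ℕ} (P : Protocol n)

lemma xin_eq_xout (t : ℕ) (i j : Fin n) : P.xin t i j = P.xout t j i := by
  induction t with
  | zero => rw [P.hxin0, P.hxout0]
  | succ t ih =>
    by_cases h : P.E (t + 1) i j
    · rw [P.hxinE _ (by omega) _ _ h, P.hxoutE _ (by omega) _ _ (P.Esymm _ _ _ h)]
      simp [ih]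
    · rw [P.hxinN _ (by omega) _ _ h,
        P.hxoutN _ (by omega) _ _ (fun h' => h (P.Esymm _ _ _ h'))]
      simpa using ih

lemma card_S_le {s : ℕ} {i j : Fin n} (hj : j ∈ P.S s i) : ((P.S s i).card : ℝ) ≤ P.D i j s := by
  have hE : P.E s i j := by simp [S] at hj; exact hj.1
  refine le_trans ?_ (P.Dbound s i j hE)
  rw [Nat.cast_le]
  refine le_trans ?_ (le_max_left _ _)
  rw [← Set.ncard_coe_finset]
  refine Set.ncard_le_ncard ?_ (Set.toFinite _)
  intro k hk
  simp [S] at hk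
  exact hk.1

/-- On the update set, the estimated difference is at most twice the true difference, with
the same sign. -/
lemma estimate_of_mem_S {s : ℕ} (hs : 1 ≤ s) {i j : Fin n} (hj : j ∈ P.S s i) {m M : ℝ}
    (hb : ∀ k, m ≤ P.x (s - 1) k ∧ P.x (s - 1) k ≤ M) :
    P.xin s i j - P.xout s i j ≤ 2 * (M - P.x (s - 1) i) ∧
      -(2 * (P.x (s - 1) i - m)) ≤ P.xin s i j - P.xout s i j := by
  simp only [S, Finset.mem_filter, Finset.mem_univ, true_and] at hj
  obtain ⟨hE, hgap, hqji, hqij⟩ := hj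
  have hE' := P.Esymm _ _ _ hE
  have hr : 0 < (s : ℝ) ^ P.α := Real.rpow_pos_of_pos (by exact_mod_cast hs) _
  have h1 : |P.x (s - 1) i - P.xout (s - 1) i j| ≤ 1 / (s : ℝ) ^ P.α := by
    apply abs_le_of_Rq_eq_zero hr
    rw [← P.hq s hs i j hE, hqij]
  have h2 : |P.x (s - 1) j - P.xout (s - 1) j i| ≤ 1 / (s : ℝ) ^ P.α := by
    apply abs_le_of_Rq_eq_zero hr
    rw [← P.hq s hs j i hE', hqji]
  have h3 : P.xout s i j = P.xout (s - 1) i j := by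
    rw [P.hxoutE s hs i j hE, hqij]; simp
  have h4 : P.xin s i j = P.xout (s - 1) j i := by
    rw [P.xin_eq_xout, P.hxoutE s hs j i hE', hqji]; simp
  rw [h3, h4] at hgap ⊢
  have e4 : 4 / (s : ℝ) ^ P.α = 4 * (1 / (s : ℝ) ^ P.α) := by ring
  rw [e4] at hgap
  have hbi := hb i
  have hbj := hb j
  rw [abs_le] at h1 h2
  rcases lt_abs.mp hgap with h | h <;> constructor <;> linarith

lemma step_bounds {s : ℕ} (hs : 1 ≤ s) (i : Fin n) {m M : ℝ}
    (hb : ∀ k, m ≤ P.x (s - 1) k ∧ P.x (s - 1) k ≤ M) :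
    P.x s i - P.x (s - 1) i ≤ 1 / (s : ℝ) ^ P.β * ((M - P.x (s - 1) i) / 2) ∧
      -(1 / (s : ℝ) ^ P.β * ((P.x (s - 1) i - m) / 2)) ≤ P.x s i - P.x (s - 1) i := by
  have hx := P.hx s hs i
  change P.x s i = P.x (s - 1) i + (1 / (s : ℝ) ^ P.β) *
    ∑ j ∈ P.S s i, (P.xin s i j - P.xout s i j) / (4 * P.D i j s) at hx
  have hβ : 0 < (s : ℝ) ^ P.β := Real.rpow_pos_of_pos (by exact_mod_cast hs) _
  have hc : ∀ j ∈ P.S s i, (0 : ℝ) < (P.S s i).card := fun j hj => by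
    exact_mod_cast Finset.card_pos.mpr ⟨j, hj⟩
  have key : ∀ (c D w a : ℝ), 0 < c → c ≤ D → 0 ≤ a → w ≤ 2 * a →
      w / (4 * D) ≤ a / 2 / c := by
    intro c D w a hc hD ha hw
    have hD0 : 0 < D := by linarith
    rw [div_div, div_le_div_iff₀ (by positivity) (by positivity)]
    nlinarith [mul_le_mul_of_nonneg_left hD ha, mul_le_mul_of_nonneg_right hw hc.le]
  have up : ∑ j ∈ P.S s i, (P.xin s i j - P.xout s i j) / (4 * P.D i j s) ≤
      (M - P.x (s - 1) i) / 2 := by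
    apply Finset.sum_le_of_le_div_card
    · linarith [(hb i).2]
    · intro j hj
      exact key _ _ _ _ (hc j hj) (P.card_S_le hj) (by linarith [(hb i).2])
        (P.estimate_of_mem_S hs hj hb).1
  have dn : ∑ j ∈ P.S s i, -((P.xin s i j - P.xout s i j) / (4 * P.D i j s)) ≤
      (P.x (s - 1) i - m) / 2 := by
    apply Finset.sum_le_of_le_div_card
    · linarith [(hb i).1]
    · intro j hj
      rw [← neg_div]
      exact key _ _ _ _ (hc j hj) (P.card_S_le hj) (by linarith [(hb i).1])
        (by linarith [(P.estimate_of_mem_S hs hj hb).2])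
  rw [Finset.sum_neg_distrib] at dn
  have hp : 0 ≤ 1 / (s : ℝ) ^ P.β := by positivity
  rw [hx]
  constructor
  · linarith [mul_le_mul_of_nonneg_left up hp]
  · linarith [mul_le_mul_of_nonneg_left dn hp]

lemma x_mem_Icc {m M : ℝ} (hb : ∀ k, m ≤ P.x 0 k ∧ P.x 0 k ≤ M) (s : ℕ) :
    ∀ k, m ≤ P.x s k ∧ P.x s k ≤ M := by
  induction s with
  | zero => exact hb
  | succ s ih =>
    intro k
    have h := P.step_bounds (s := s + 1) (by omega) k (by simpa using ih)
    simp only [Nat.add_sub_cancel] at h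
    have h1 : (1 : ℝ) ≤ ((s + 1 : ℕ) : ℝ) ^ P.β :=
      Real.one_le_rpow (by exact_mod_cast Nat.succ_pos s) (P.hα.trans P.hαβ).le
    have h2 : 1 / ((s + 1 : ℕ) : ℝ) ^ P.β ≤ 1 := by
      rw [div_le_one (by linarith)]; exact h1
    have h3 : 0 ≤ 1 / ((s + 1 : ℕ) : ℝ) ^ P.β := by positivity
    obtain ⟨hk1, hk2⟩ := ih k
    constructor <;> nlinarith

lemma abs_step_le {m M : ℝ} (hb : ∀ k, m ≤ P.x 0 k ∧ P.x 0 k ≤ M) {s : ℕ} (hs : 1 ≤ s)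
    (i : Fin n) : |P.x s i - P.x (s - 1) i| ≤ 1 / (s : ℝ) ^ P.β * ((M - m) / 2) := by
  have h := P.step_bounds hs i (P.x_mem_Icc hb (s - 1))
  have h3 : 0 ≤ 1 / (s : ℝ) ^ P.β := by positivity
  obtain ⟨hk1, hk2⟩ := P.x_mem_Icc hb (s - 1) i
  rw [abs_le]
  constructor <;> nlinarith

lemma abs_xout_le {X : ℝ} (hX : 0 ≤ X) (hb : ∀ s k, |P.x s k| ≤ X) (s : ℕ) (i j : Fin n) :
    |P.xout s i j| ≤ X := by
  induction s with
  | zero => simpa [P.hxout0] using hX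
  | succ s ih =>
    by_cases hE : P.E (s + 1) i j
    · rw [P.hxoutE _ (by omega) _ _ hE, P.hq _ (by omega) _ _ hE]
      exact abs_add_Rq_le (Real.rpow_pos_of_pos (by positivity) _) (hb _ _) ih
    · rw [P.hxoutN _ (by omega) _ _ hE]
      exact ih

lemma abs_sub_xout_le {s : ℕ} (hs : 1 ≤ s) (i j : Fin n) :
    |P.x (s - 1) i - P.xout s i j| ≤ |P.x (s - 1) i - P.xout (s - 1) i j| := by
  by_cases hE : P.E s i j
  · rw [P.hxoutE s hs i j hE, P.hq s hs i j hE, ← sub_sub]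
    exact Rq_contract (Real.rpow_pos_of_pos (by exact_mod_cast hs) _)
  · rw [P.hxoutN s hs i j hE]

lemma abs_sub_xout_progress {s : ℕ} (hs : 1 ≤ s) {i j : Fin n} (hE : P.E s i j) :
    |P.x (s - 1) i - P.xout s i j| ≤ 1 / (s : ℝ) ^ P.α ∨
      |P.x (s - 1) i - P.xout s i j| ≤
        |P.x (s - 1) i - P.xout (s - 1) i j| - 1 / (s : ℝ) ^ P.α := by
  rw [P.hxoutE s hs i j hE, P.hq s hs i j hE, ← sub_sub]
  exact Rq_progress (Real.rpow_pos_of_pos (by exact_mod_cast hs) _)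

/-- The estimation error grows at most by the drift of the estimated value. -/
lemma error_drift {i j : Fin n} {s δ : ℝ} {a : ℕ}
    (hδ : ∀ u : ℕ, a < u → |P.x u i - P.x (u - 1) i| ≤ δ) (hs : |P.x a i - P.xout a i j| ≤ s)
    (k : ℕ) : |P.x (a + k) i - P.xout (a + k) i j| ≤ s + k * δ := by
  induction k with
  | zero => simpa using hs
  | succ k ih =>
    have h1 := P.abs_sub_xout_le (s := a + (k + 1)) (by omega) i j
    have h2 := hδ (a + (k + 1)) (by omega)
    have h3 : a + (k + 1) - 1 = a + k := by omega
    rw [h3] at h1 h2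
    have h4 := abs_sub_le (P.x (a + (k + 1)) i) (P.x (a + k) i) (P.xout (a + (k + 1)) i j)
    push_cast
    linarith

/-- The estimate `x̂_{i,j,out}` reaches resolution `1 / τ ^ α` at some time `τ` of the
window `[kB + 1, (k + 1)B]`. -/
def CaughtUp (B k : ℕ) (i j : Fin n) : Prop :=
  ∃ τ, k * B + 1 ≤ τ ∧ τ ≤ (k + 1) * B ∧
    |P.x (τ - 1) i - P.xout τ i j| ≤ 1 / (τ : ℝ) ^ P.α

section Dynamics

variable {P} {B T : ℕ} {i j : Fin n}

lemma drift_le_of_lt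
    (hdrift : ∀ u : ℕ, T ≤ u → |P.x u i - P.x (u - 1) i| ≤ 1 / (u : ℝ) ^ P.α / (16 * B))
    {a u : ℕ} (ha : 0 < a) (haT : T ≤ a) (hu : a ≤ u) :
    |P.x u i - P.x (u - 1) i| ≤ 1 / (a : ℝ) ^ P.α / (16 * B) := by
  refine (hdrift u (by omega)).trans ?_
  have h1 : (0 : ℝ) < (a : ℝ) ^ P.α := Real.rpow_pos_of_pos (by exact_mod_cast ha) _
  have h2 : (a : ℝ) ^ P.α ≤ (u : ℝ) ^ P.α :=
    Real.rpow_le_rpow (by positivity) (by exact_mod_cast hu) P.hα.le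
  gcongr

lemma error_le_after_caught (hB : 0 < B)
    (hdrift : ∀ u : ℕ, T ≤ u → |P.x u i - P.x (u - 1) i| ≤ 1 / (u : ℝ) ^ P.α / (16 * B))
    {τ u : ℕ} (hτ0 : 0 < τ) (hτ : T ≤ τ) (hu : τ < u) (hu' : u ≤ τ + 2 * B)
    (h : |P.x (τ - 1) i - P.xout τ i j| ≤ 1 / (τ : ℝ) ^ P.α) :
    |P.x (u - 1) i - P.xout (u - 1) i j| ≤ 9 / 8 * (1 / (τ : ℝ) ^ P.α) := by
  set p := 1 / (τ : ℝ) ^ P.α with hp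
  have hp0 : 0 ≤ p := by positivity
  have hB' : (0 : ℝ) < B := by exact_mod_cast hB
  have h1 : |P.x τ i - P.xout τ i j| ≤ p + p / (16 * B) := by
    have := drift_le_of_lt hdrift hτ0 hτ le_rfl
    have h4 := abs_sub_le (P.x τ i) (P.x (τ - 1) i) (P.xout τ i j)
    linarith
  obtain ⟨k, rfl⟩ : ∃ k, u = τ + k + 1 := ⟨u - τ - 1, by omega⟩
  have h2 := P.error_drift (fun u hu => drift_le_of_lt hdrift hτ0 hτ hu.le) h1 k
  have h3 : (k : ℝ) + 1 ≤ 2 * B := by exact_mod_cast (by omega : k + 1 ≤ 2 * B)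
  have h4 : (2 * B) * (p / (16 * B)) = p / 8 := by field_simp; ring
  have h5 : ((k : ℝ) + 1) * (p / (16 * B)) ≤ (2 * B) * (p / (16 * B)) := by gcongr
  simp only [Nat.add_sub_cancel]
  linarith

lemma CaughtUp.succ (hB : 0 < B)
    (hwin : ∀ k : ℕ, ∃ s, k * B + 1 ≤ s ∧ s ≤ (k + 1) * B ∧ P.E s i j)
    (hdrift : ∀ u : ℕ, T ≤ u → |P.x u i - P.x (u - 1) i| ≤ 1 / (u : ℝ) ^ P.α / (16 * B))
    (hTB : 32 * B ≤ T) {k : ℕ} (hk : T ≤ k * B) (h : P.CaughtUp B k i j) :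
    P.CaughtUp B (k + 1) i j := by
  obtain ⟨τ, hτ1, hτ2, hτ⟩ := h
  obtain ⟨s, hs1, hs2, hE⟩ := hwin (k + 1)
  refine ⟨s, hs1, hs2, ?_⟩
  rw [show (k + 1 + 1) * B = k * B + 2 * B by ring] at hs2
  have h1 := error_le_after_caught hB hdrift (u := s) (by omega) (by omega) (by omega)
    (by omega) hτ
  rcases P.abs_sub_xout_progress (by omega) hE with h2 | h2
  · exact h2
  · have h3 : 1 / (τ : ℝ) ^ P.α ≤ 16 / 9 * (1 / (s : ℝ) ^ P.α) := by
      apply one_div_rpow_le_mul P.hα.le (P.hαβ.trans P.hβ).le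
      · exact_mod_cast (by omega : 0 < τ)
      · exact_mod_cast (by omega : 0 < s)
      · norm_num
      · have : ((9 * s : ℕ) : ℝ) ≤ ((16 * τ : ℕ) : ℝ) := by
          exact_mod_cast (by omega : 9 * s ≤ 16 * τ)
        push_cast at this
        linarith
    linarith

lemma error_decrease (hB : 0 < B)
    (hwin : ∀ k : ℕ, ∃ s, k * B + 1 ≤ s ∧ s ≤ (k + 1) * B ∧ P.E s i j)
    (hdrift : ∀ u : ℕ, T ≤ u → |P.x u i - P.x (u - 1) i| ≤ 1 / (u : ℝ) ^ P.α / (16 * B))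
    (hTB : 32 * B ≤ T) {k : ℕ} (hk : T ≤ k * B) (h : ¬ P.CaughtUp B k i j) :
    |P.x ((k + 1) * B) i - P.xout ((k + 1) * B) i j| ≤
      |P.x (k * B) i - P.xout (k * B) i j| - 1 / 2 * (1 / (((k + 1) * B : ℕ) : ℝ) ^ P.α) := by
  obtain ⟨s, hs1, hs2, hE⟩ := hwin k
  have hns : ¬ |P.x (s - 1) i - P.xout s i j| ≤ 1 / (s : ℝ) ^ P.α :=
    fun h' => h ⟨s, hs1, hs2, h'⟩
  have hw : (k + 1) * B = k * B + B := by ring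
  rw [hw] at hs2 ⊢
  generalize k * B = a at *
  have ha : 0 < a := by omega
  have hB' : (0 : ℝ) < B := by exact_mod_cast hB
  set p := 1 / (a : ℝ) ^ P.α with hp
  have hd : ∀ u : ℕ, a < u → |P.x u i - P.x (u - 1) i| ≤ p / (16 * B) :=
    fun u hu => drift_le_of_lt hdrift ha hk hu.le
  obtain ⟨l, rfl⟩ : ∃ l, s = a + l + 1 := ⟨s - a - 1, by omega⟩
  obtain ⟨m, rfl⟩ : ∃ m, B = l + 1 + m := ⟨B - (l + 1), by omega⟩
  have h1 := P.error_drift (j := j) hd le_rfl l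
  have h2 := (P.abs_sub_xout_progress (by omega) hE).resolve_left hns
  simp only [Nat.add_sub_cancel] at h2
  have h3 := hd (a + l + 1) (by omega)
  simp only [Nat.add_sub_cancel] at h3
  have h4 := abs_sub_le (P.x (a + l + 1) i) (P.x (a + l) i) (P.xout (a + l + 1) i j)
  have h5 := P.error_drift (j := j) (a := a + l + 1) (fun u hu => hd u (by omega)) le_rfl m
  rw [show a + l + 1 + m = a + (l + 1 + m) by ring] at h5
  have h6 : p ≤ 2 * (1 / ((a + (l + 1 + m) : ℕ) : ℝ) ^ P.α) := by
    apply one_div_rpow_le_mul P.hα.le (P.hαβ.trans P.hβ).le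
    · exact_mod_cast ha
    · exact_mod_cast (by omega : 0 < a + (l + 1 + m))
    · norm_num
    · exact_mod_cast (by omega : a + (l + 1 + m) ≤ 2 * a)
  have h7 : 1 / ((a + (l + 1 + m) : ℕ) : ℝ) ^ P.α ≤ 1 / ((a + l + 1 : ℕ) : ℝ) ^ P.α := by
    apply one_div_le_one_div_of_le
    · exact Real.rpow_pos_of_pos (by exact_mod_cast (by omega : 0 < a + l + 1)) _
    · exact Real.rpow_le_rpow (by positivity)
        (by exact_mod_cast (by omega : a + l + 1 ≤ a + (l + 1 + m))) P.hα.le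
  have h8 : ((l : ℝ) + 1 + m) * (p / (16 * ((l + 1 + m : ℕ) : ℝ))) = p / 16 := by
    push_cast
    have : (l : ℝ) + 1 + m ≠ 0 := by positivity
    field_simp
  have h9 : 0 ≤ 1 / ((a + (l + 1 + m) : ℕ) : ℝ) ^ P.α := by positivity
  linarith

lemma exists_caughtUp_or_error_le (hB : 0 < B)
    (hwin : ∀ k : ℕ, ∃ s, k * B + 1 ≤ s ∧ s ≤ (k + 1) * B ∧ P.E s i j)
    (hdrift : ∀ u : ℕ, T ≤ u → |P.x u i - P.x (u - 1) i| ≤ 1 / (u : ℝ) ^ P.α / (16 * B))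
    (hTB : 32 * B ≤ T) {K t : ℕ} (hK : T ≤ K * B) {e : ℝ}
    (he : |P.x (K * B) i - P.xout (K * B) i j| ≤ e) (m : ℕ) (hm : (K + m) * B ≤ t) :
    (∃ l < m, P.CaughtUp B (K + l) i j) ∨
      |P.x ((K + m) * B) i - P.xout ((K + m) * B) i j| ≤
        e - m * (1 / 2 * (1 / (t : ℝ) ^ P.α)) := by
  induction m with
  | zero => right; simpa using he
  | succ m ih =>
    have hle : (K + m) * B ≤ (K + m + 1) * B := Nat.mul_le_mul_right _ (by omega)
    rw [← add_assoc] at hm ⊢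
    have hKm : T ≤ (K + m) * B := hK.trans (Nat.mul_le_mul_right _ (by omega))
    rcases ih (by omega) with ⟨l, hl, hc⟩ | ih
    · exact Or.inl ⟨l, by omega, hc⟩
    · by_cases hc : P.CaughtUp B (K + m) i j
      · exact Or.inl ⟨m, by omega, hc⟩
      · right
        have h1 := error_decrease hB hwin hdrift hTB hKm hc
        have h2 : 1 / (t : ℝ) ^ P.α ≤ 1 / (((K + m + 1) * B : ℕ) : ℝ) ^ P.α := by
          apply one_div_le_one_div_of_le
          · exact Real.rpow_pos_of_pos (by exact_mod_cast (by omega : 0 < (K + m + 1) * B)) _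
          · exact Real.rpow_le_rpow (by positivity) (by exact_mod_cast hm) P.hα.le
        rw [Nat.cast_succ]
        linarith

/-- The error estimate, for a transient long enough compared with the initial error bound. -/
lemma error_le_of_transient (hB : 0 < B)
    (hwin : ∀ k : ℕ, ∃ s, k * B + 1 ≤ s ∧ s ≤ (k + 1) * B ∧ P.E s i j)
    (hdrift : ∀ u : ℕ, T ≤ u → |P.x u i - P.x (u - 1) i| ≤ 1 / (u : ℝ) ^ P.α / (16 * B))
    (hTB : 32 * B ≤ T) {X : ℝ} (hX : 0 ≤ X) (hb : ∀ s k, |P.x s k| ≤ X) {t : ℕ}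
    (htT : 4 * T ≤ t) (htX : 32 * B * X ≤ (t : ℝ) ^ (1 - P.α)) :
    |P.x (t - 1) i - P.xout t i j| ≤ (9 / 8) / ((t : ℝ) - 2 * B - 1) ^ P.α := by
  have hB' : (0 : ℝ) < B := by exact_mod_cast hB
  have ht0 : (0 : ℝ) < t := by exact_mod_cast (by omega : 0 < t)
  have hta : (0 : ℝ) < (t : ℝ) ^ P.α := Real.rpow_pos_of_pos ht0 _
  obtain ⟨K, hK1, hK2⟩ : ∃ K, T ≤ K * B ∧ K * B ≤ T + B := by
    refine ⟨T / B + 1, ?_, ?_⟩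
    · have := Nat.lt_div_mul_add (a := T) hB
      rw [add_mul]; omega
    · have := Nat.div_mul_le_self T B
      rw [add_mul]; omega
  obtain ⟨k, hk1, hk2⟩ : ∃ k, k * B + 1 ≤ t ∧ t ≤ (k + 1) * B := by
    refine ⟨(t - 1) / B, ?_, ?_⟩
    · have := Nat.div_mul_le_self (t - 1) B
      omega
    · have := Nat.lt_div_mul_add (a := t - 1) hB
      rw [add_mul]; omega
  have hKk : K ≤ k := by
    by_contra hlt
    have : (k + 1) * B ≤ K * B := Nat.mul_le_mul_right _ (by omega)
    omega
  obtain ⟨m, rfl⟩ := Nat.exists_eq_add_of_le hKk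
  have he : |P.x (K * B) i - P.xout (K * B) i j| ≤ 2 * X := by
    have h1 := hb (K * B) i
    have h2 := P.abs_xout_le hX hb (K * B) i j
    have h3 := abs_sub (P.x (K * B) i) (P.xout (K * B) i j)
    linarith
  have hcaught : ∃ l < m, P.CaughtUp B (K + l) i j := by
    refine (exists_caughtUp_or_error_le hB hwin hdrift hTB hK1 he m
      (t := t) (by omega)).resolve_right fun hle => ?_
    have h0 := (abs_nonneg _).trans hle
    have hmB : t ≤ 2 * (m * B) := by
      have : (K + m + 1) * B = K * B + m * B + B := by ring
      omega
    have hmB' : (t : ℝ) ≤ 2 * (m * B) := by exact_mod_cast hmB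
    have hsplit : (t : ℝ) ^ (1 - P.α) = t * (1 / (t : ℝ) ^ P.α) := by
      rw [Real.rpow_sub ht0, Real.rpow_one]; ring
    have hpos : 0 < (t : ℝ) ^ (1 - P.α) := Real.rpow_pos_of_pos ht0 _
    have hp : 0 ≤ 1 / (t : ℝ) ^ P.α := by positivity
    have h1 := mul_le_mul_of_nonneg_right hmB' hp
    have h2 := mul_nonneg hB'.le h0
    rw [hsplit] at htX hpos
    nlinarith
  obtain ⟨l, hl, hc⟩ := hcaught
  have hpersist : ∀ r, P.CaughtUp B (K + l + r) i j := by
    intro r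
    induction r with
    | zero => exact hc
    | succ r ih =>
      have hle : K ≤ K + l + r := by omega
      exact ih.succ hB hwin hdrift hTB (hK1.trans (Nat.mul_le_mul_right _ hle))
  obtain ⟨r, rfl⟩ : ∃ r, m = l + r + 1 := ⟨m - l - 1, by omega⟩
  obtain ⟨τ, hτ1, hτ2, hτ⟩ := hpersist r
  have hKB : K * B ≤ (K + l + r) * B := Nat.mul_le_mul_right _ (by omega)
  have e1 : (K + (l + r + 1)) * B = (K + l + r) * B + B := by ring
  have e2 : (K + (l + r + 1) + 1) * B = (K + l + r) * B + 2 * B := by ring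
  have e3 : (K + l + r + 1) * B = (K + l + r) * B + B := by ring
  rw [e1] at hk1
  rw [e2] at hk2
  rw [e3] at hτ2
  have h1 := error_le_after_caught hB hdrift (u := t) (by omega) (by omega) (by omega)
    (by omega) hτ
  refine (P.abs_sub_xout_le (by omega) i j).trans (h1.trans ?_)
  have hlow : (t : ℝ) - 2 * B - 1 ≤ τ := by
    have : (t : ℝ) ≤ τ + 2 * B := by exact_mod_cast (by omega : t ≤ τ + 2 * B)
    linarith
  have hlow0 : 0 < (t : ℝ) - 2 * B - 1 := by
    have : (2 * B + 1 : ℝ) < t := by exact_mod_cast (by omega : 2 * B + 1 < t)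
    linarith
  rw [mul_one_div]
  have := Real.rpow_pos_of_pos hlow0 P.α
  have := Real.rpow_le_rpow hlow0.le hlow P.hα.le
  gcongr

end Dynamics

end Protocol

lemma le_rpow_of_rpow_one_div_le {c γ u : ℝ} (hc : 0 ≤ c) (hγ : 0 < γ) (h : c ^ (1 / γ) ≤ u) :
    c ≤ u ^ γ := by
  calc c = (c ^ (1 / γ)) ^ γ := by
        rw [← Real.rpow_mul hc, one_div_mul_cancel hγ.ne', Real.rpow_one]
    _ ≤ u ^ γ := Real.rpow_le_rpow (Real.rpow_nonneg hc _) h hγ.le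

/-- on core edges, after a transient the estimation error is at most
`(9/8)/(t - 2B - 1)^α`. -/
theorem stmt10_core_estimate {n : ℕ} (hn : 1 ≤ n) (P : Protocol n)
    (B : ℕ) (hB : 0 < B) (Einf : Fin n → Fin n → Prop)
    (hcore : P.CoreConnected B Einf) (i j : Fin n) (hij : Einf i j)
    (t : ℕ)
    (ht : (2 : ℝ) ^ ((2 : ℝ) / (1 - P.α)) *
        (⌈(32 * (B : ℝ) + 8 * B * Wsp (P.x 0)) ^ ((1 : ℝ) / (P.β - P.α))⌉ : ℝ) +
        (32 * B * normInf (P.x 0)) ^ ((2 : ℝ) / (1 - P.α)) ≤ (t : ℝ)) :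
    |P.xin t i j - P.x (t - 1) j| ≤ (9 / 8) / ((t : ℝ) - 2 * B - 1) ^ P.α := by
  have : Nonempty (Fin n) := ⟨i⟩
  have hα := P.hα
  have hαβ := P.hαβ
  have hβ := P.hβ
  have hB1 : (1 : ℝ) ≤ B := by exact_mod_cast hB
  have hmM : ∀ k, minV (P.x 0) ≤ P.x 0 k ∧ P.x 0 k ≤ maxV (P.x 0) := fun k =>
    ⟨ciInf_le (Set.finite_range _).bddBelow k, le_ciSup (Set.finite_range _).bddAbove k⟩
  have hX0 : ∀ k, |P.x 0 k| ≤ normInf (P.x 0) := fun k =>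
    le_ciSup (f := fun k => |P.x 0 k|) (Set.finite_range _).bddAbove k
  have hW : 0 ≤ Wsp (P.x 0) := sub_nonneg.mpr ((hmM i).1.trans (hmM i).2)
  have hX : 0 ≤ normInf (P.x 0) := (abs_nonneg _).trans (hX0 i)
  have hb : ∀ s k, |P.x s k| ≤ normInf (P.x 0) := fun s k =>
    abs_le.mpr (P.x_mem_Icc (fun k => abs_le.mp (hX0 k)) s k)
  set W := Wsp (P.x 0) with hWdef
  set X := normInf (P.x 0)
  set c := 32 * (B : ℝ) + 8 * B * W with hc
  have hBW : 0 ≤ 8 * B * W := by positivity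
  have hc1 : 1 ≤ c := by linarith
  have hT0 : 0 ≤ ⌈c ^ ((1 : ℝ) / (P.β - P.α))⌉ := Int.ceil_nonneg (by positivity)
  have hceil := Int.le_ceil (c ^ ((1 : ℝ) / (P.β - P.α)))
  obtain ⟨T, hT⟩ := Int.eq_ofNat_of_zero_le hT0
  rw [hT, Int.cast_natCast] at ht hceil
  have hcT : c ≤ T := by
    refine le_trans ?_ hceil
    conv_lhs => rw [← Real.rpow_one c]
    apply Real.rpow_le_rpow_of_exponent_le hc1
    rw [le_div_iff₀ (by linarith)]
    linarith
  have hcTγ : c ≤ (T : ℝ) ^ (P.β - P.α) :=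
    le_rpow_of_rpow_one_div_le (by linarith) (by linarith) hceil
  have hTB : 32 * B ≤ T := by
    have : (32 * B : ℝ) ≤ T := by linarith
    exact_mod_cast this
  have hu : 0 ≤ 32 * B * X := by positivity
  have hu' : 0 ≤ (32 * B * X) ^ ((2 : ℝ) / (1 - P.α)) := Real.rpow_nonneg hu _
  have htT : 4 * T ≤ t := by
    have h4 : (4 : ℝ) ≤ (2 : ℝ) ^ ((2 : ℝ) / (1 - P.α)) := by
      calc (4 : ℝ) = (2 : ℝ) ^ (2 : ℝ) := by norm_num
        _ ≤ _ := by
          apply Real.rpow_le_rpow_of_exponent_le (by norm_num)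
          rw [le_div_iff₀ (by linarith)]
          linarith
    have : (4 * T : ℝ) ≤ t := by nlinarith
    exact_mod_cast this
  have htX : 32 * B * X ≤ (t : ℝ) ^ (1 - P.α) := by
    have h1 : (1 : ℝ) ≤ (t : ℝ) ^ (1 - P.α) :=
      Real.one_le_rpow (by exact_mod_cast (by omega : 1 ≤ t)) (by linarith)
    rcases le_total (32 * B * X) 1 with h | h
    · exact h.trans h1
    · apply le_rpow_of_rpow_one_div_le hu (by linarith)
      refine (Real.rpow_le_rpow_of_exponent_le h ?_).trans
        (le_trans (le_add_of_nonneg_left (by positivity)) ht)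
      have : 0 < 1 - P.α := by linarith
      gcongr
      norm_num
  have hwin : ∀ k : ℕ, ∃ s, k * B + 1 ≤ s ∧ s ≤ (k + 1) * B ∧ P.E s j i := fun k => by
    obtain ⟨s, h1, h2, h3⟩ := hcore.2.2 k i j hij
    exact ⟨s, h1, h2, P.Esymm _ _ _ h3⟩
  have hdrift : ∀ u : ℕ, T ≤ u →
      |P.x u j - P.x (u - 1) j| ≤ 1 / (u : ℝ) ^ P.α / (16 * B) := by
    intro u hTu
    refine (P.abs_step_le hmM (by omega) j).trans ?_
    have hu0 : (0 : ℝ) < u := by exact_mod_cast (by omega : 0 < u)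
    have h1 : c ≤ (u : ℝ) ^ (P.β - P.α) :=
      hcTγ.trans (Real.rpow_le_rpow (by positivity) (by exact_mod_cast hTu) (by linarith))
    have h2 : (u : ℝ) ^ P.β = (u : ℝ) ^ (P.β - P.α) * (u : ℝ) ^ P.α := by
      rw [← Real.rpow_add hu0]; congr 1; ring
    change 1 / (u : ℝ) ^ P.β * (W / 2) ≤ _
    have hua : 0 < (u : ℝ) ^ P.α := Real.rpow_pos_of_pos hu0 _
    have hub : 0 < (u : ℝ) ^ (P.β - P.α) := Real.rpow_pos_of_pos hu0 _
    rw [h2, div_mul_div_comm, div_div, div_le_div_iff₀ (by positivity) (by positivity)]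
    have h3 : 8 * B * W ≤ (u : ℝ) ^ (P.β - P.α) := by linarith
    nlinarith [mul_le_mul_of_nonneg_right h3 hua.le]
  rw [P.xin_eq_xout, abs_sub_comm]
  exact Protocol.error_le_of_transient hB hwin hdrift hTB hX hb htT htX
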